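/- arXiv:1304.8089 — 5 statements merged into one kernel-verified Lean document; each statement's English description precedes it below -/
import Mathlib

section
/- Let X and Y be intervals with centers c_X, c_Y ∈ ℝ and half-ranges r_X, r_Y ≥ 0, represented under the Uniform assumption by the quantile functions Ψ_X(t) = c_X + r_X(2t − 1) and Ψ_Y(t) = c_Y + r_Y(2t − 1) for t ∈ [0,1]. Then the squared Mallows distance satisfies D_M²(Ψ_X, Ψ_Y) = (c_X − c_Y)² + (1/3)(r_X − r_Y)². -/
/-- The squared Mallows distance between two intervals (under the Uniform
assumption), represented by their quantile functions
`Ψ_X(t) = c_X + r_X (2t − 1)` and `Ψ_Y(t) = c_Y + r_Y (2t − 1)`, equals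
`(c_X − c_Y)² + (1/3)(r_X − r_Y)²`. -/
theorem mallows_sq_dist_uniform_intervals
    (cX cY rX rY : ℝ) (hrX : 0 ≤ rX) (hrY : 0 ≤ rY) :
    (∫ t in (0:ℝ)..1,
        ((cX + rX * (2 * t - 1)) - (cY + rY * (2 * t - 1))) ^ 2)
      = (cX - cY) ^ 2 + (1 / 3) * (rX - rY) ^ 2 := by
  have hderiv : ∀ t ∈ Set.uIcc (0 : ℝ) 1,
      HasDerivAt (fun t : ℝ => (cX - cY) ^ 2 * t + 2 * (cX - cY) * (rX - rY) * (t ^ 2 - t)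
          + (rX - rY) ^ 2 * (4 / 3 * t ^ 3 - 2 * t ^ 2 + t))
        (((cX + rX * (2 * t - 1)) - (cY + rY * (2 * t - 1))) ^ 2) t := by
    intro t _
    have h1 := hasDerivAt_id' t
    have h2 := hasDerivAt_pow 2 t
    have h3 := hasDerivAt_pow 3 t
    refine (((h1.const_mul ((cX - cY) ^ 2)).add
      ((h2.sub h1).const_mul (2 * (cX - cY) * (rX - rY)))).add
      ((((h3.const_mul (4 / 3)).sub (h2.const_mul 2)).add h1).const_mul
        ((rX - rY) ^ 2))).congr_deriv ?_
    push_cast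
    ring
  rw [intervalIntegral.integral_eq_sub_of_hasDerivAt hderiv
    (Continuous.intervalIntegrable (by fun_prop) _ _)]
  ring
end

section
/- In the single-variable DSD fitting problem, if the half-ranges r_{X(j)} (j = 1,…,m) are not all zero and the centers c_{X(j)} (j = 1,…,m) are not all equal, then the objective f(α, β, γ) is strictly convex on ℝ³; consequently the constrained minimization of f over the feasible region {α ≥ 0, β ≥ 0, γ ∈ ℝ} has at most one optimal solution. -/
/-- The quadratic part of the single-variable DSD objective is positive definite when the
half-ranges are not all zero and the centers are not all equal. -/
lemma dsd_quadratic_pos {ι : Type*} [Fintype ι] {c r : ι → ℝ}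
    (hr : ∃ j, r j ≠ 0) (hc : ∃ j j', c j ≠ c j') {d : ℝ × ℝ × ℝ} (hd : d ≠ 0) :
    0 < ∑ j, (((d.1 - d.2.1) * c j + d.2.2) ^ 2 + (1 / 3) * ((d.1 + d.2.1) * r j) ^ 2) := by
  have hnonneg : ∀ j ∈ Finset.univ,
      0 ≤ ((d.1 - d.2.1) * c j + d.2.2) ^ 2 + (1 / 3) * ((d.1 + d.2.1) * r j) ^ 2 :=
    fun j _ => by positivity
  refine (Finset.sum_nonneg hnonneg).lt_of_ne' fun h => hd ?_
  rw [Finset.sum_eq_zero_iff_of_nonneg hnonneg] at h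
  have hcenter (j) : (d.1 - d.2.1) * c j + d.2.2 = 0 := by
    have := h j (Finset.mem_univ j)
    exact pow_eq_zero_iff two_ne_zero |>.1 (by
      nlinarith [sq_nonneg ((d.1 - d.2.1) * c j + d.2.2), sq_nonneg ((d.1 + d.2.1) * r j)])
  have hrange (j) : (d.1 + d.2.1) * r j = 0 := by
    have := h j (Finset.mem_univ j)
    exact pow_eq_zero_iff two_ne_zero |>.1 (by
      nlinarith [sq_nonneg ((d.1 - d.2.1) * c j + d.2.2), sq_nonneg ((d.1 + d.2.1) * r j)])
  obtain ⟨i, hi⟩ := hr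
  obtain ⟨j, k, hjk⟩ := hc
  have hsum : d.1 + d.2.1 = 0 := (mul_eq_zero.1 (hrange i)).resolve_right hi
  have hdiff : d.1 - d.2.1 = 0 := by
    have : (d.1 - d.2.1) * (c j - c k) = 0 := by linear_combination hcenter j - hcenter k
    exact (mul_eq_zero.1 this).resolve_right (sub_ne_zero.2 hjk)
  have hlast : d.2.2 = 0 := by simpa [hdiff] using hcenter j
  ext
  · simp only [Prod.fst_zero]; linarith
  · simp only [Prod.fst_zero, Prod.snd_zero]; linarith
  · simpa using hlast

/-- Single-variable DSD fitting: if the half-ranges `r_{X(j)}` are not all zero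
and the centers `c_{X(j)}` are not all equal, then the objective `f` is
strictly convex on `ℝ³`, and hence the constrained minimization of `f` over
`{α ≥ 0, β ≥ 0, γ ∈ ℝ}` has at most one optimal solution. -/
theorem dsd_single_strictConvex_unique_minimizer (m : ℕ)
    (cX rX cY rY : Fin m → ℝ) (hrX : ∀ j, 0 ≤ rX j) (hrY : ∀ j, 0 ≤ rY j)
    (hr : ∃ j, rX j ≠ 0) (hc : ∃ j j' : Fin m, cX j ≠ cX j')
    (f : ℝ × ℝ × ℝ → ℝ)
    (hf : f = fun x => ∑ j, ((cY j - (x.1 - x.2.1) * cX j - x.2.2) ^ 2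
        + (1 / 3) * (rY j - (x.1 + x.2.1) * rX j) ^ 2)) :
    StrictConvexOn ℝ Set.univ f ∧
      ∀ x y : ℝ × ℝ × ℝ, 0 ≤ x.1 → 0 ≤ x.2.1 → 0 ≤ y.1 → 0 ≤ y.2.1 →
        (∀ z : ℝ × ℝ × ℝ, 0 ≤ z.1 → 0 ≤ z.2.1 → f x ≤ f z) →
        (∀ z : ℝ × ℝ × ℝ, 0 ≤ z.1 → 0 ≤ z.2.1 → f y ≤ f z) →
        x = y := by
  have hconv : StrictConvexOn ℝ Set.univ f := by
    refine ⟨convex_univ, fun x _ y _ hxy a b ha hb hab => ?_⟩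
    have hpos := mul_pos (mul_pos ha hb) (dsd_quadratic_pos hr hc (sub_ne_zero.2 hxy))
    have hgap : a • f x + b • f y - f (a • x + b • y) =
        a * b * ∑ j, ((((x - y).1 - (x - y).2.1) * cX j + (x - y).2.2) ^ 2
          + (1 / 3) * (((x - y).1 + (x - y).2.1) * rX j) ^ 2) := by
      obtain rfl : b = 1 - a := by linarith
      simp only [hf, smul_eq_mul, Finset.mul_sum, ← Finset.sum_add_distrib,
        ← Finset.sum_sub_distrib]
      refine Finset.sum_congr rfl fun j _ => ?_
      simp only [Prod.fst_add, Prod.snd_add, Prod.smul_fst, Prod.smul_snd, Prod.fst_sub,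
        Prod.snd_sub, smul_eq_mul]
      ring
    linarith
  refine ⟨hconv, fun x y hx₁ hx₂ hy₁ hy₂ hx hy => ?_⟩
  have hfeasible : Convex ℝ {z : ℝ × ℝ × ℝ | 0 ≤ z.1 ∧ 0 ≤ z.2.1} := by
    rintro u ⟨hu₁, hu₂⟩ v ⟨hv₁, hv₂⟩ a b ha hb -
    constructor <;> simp only [Prod.fst_add, Prod.snd_add, Prod.smul_fst, Prod.smul_snd,
      smul_eq_mul] <;> positivity
  exact (hconv.subset (Set.subset_univ _) hfeasible).eq_of_isMinOn
    (fun z hz => hx z hz.1 hz.2) (fun z hz => hy z hz.1 hz.2) ⟨hx₁, hx₂⟩ ⟨hy₁, hy₂⟩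
end

section
/- In the single-variable DSD fitting problem, assume S_c > 0 and S_r > 0. If (α*, β*, γ*) is a global minimizer of f over the feasible region {α ≥ 0, β ≥ 0, γ ∈ ℝ} with α* > 0 and β* > 0, then α* = (S_{cc} S_r + S_{rr} S_c)/(2 S_c S_r), β* = (−S_{cc} S_r + S_{rr} S_c)/(2 S_c S_r), and γ* = Ȳ − (α* − β*) X̄. -/
/-- A point with positive coordinate can be moved towards any other point by a positive
fraction `s` of the way, for all `t ≤ s`, while the coordinate stays nonnegative. -/
lemma exists_pos_forall_convex_combination_nonneg {x : ℝ} (hx : 0 < x) (y : ℝ) :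
    ∃ s : ℝ, 0 < s ∧ ∀ t, 0 ≤ t → t ≤ s → 0 ≤ x + t * (y - x) := by
  have hd : 0 < x + |y| := by positivity
  refine ⟨x / (x + |y|), by positivity, fun t ht hts => ?_⟩
  rw [le_div_iff₀ hd] at hts
  nlinarith [mul_nonneg ht (by linarith [neg_abs_le y] : 0 ≤ y + |y|)]

/-- The deviations from the mean sum to zero. -/
lemma sum_sub_mean_eq_zero {m : ℕ} (hm : 1 ≤ m) (c : Fin m → ℝ) {cbar : ℝ}
    (h : cbar = (1 / (m : ℝ)) * ∑ j, c j) : ∑ j, (c j - cbar) = 0 := by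
  have hm0 : (m : ℝ) ≠ 0 := by positivity
  rw [Finset.sum_sub_distrib, h]
  simp only [Finset.sum_const, Finset.card_univ, Fintype.card_fin, nsmul_eq_mul]
  field_simp
  ring

/-- Expansion of the least-squares objective around the means of the centers. -/
lemma dsd_objective_eq {m : ℕ} (cX rX cY rY : Fin m → ℝ) {Xbar Ybar : ℝ}
    (hX : ∑ j, (cX j - Xbar) = 0) (hY : ∑ j, (cY j - Ybar) = 0) (a b g : ℝ) :
    ∑ j, ((cY j - (a - b) * cX j - g) ^ 2 + (1 / 3) * (rY j - (a + b) * rX j) ^ 2)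
      = ∑ j, (cY j - Ybar) ^ 2 + (1 / 3) * ∑ j, rY j ^ 2
        + m * (Ybar - (a - b) * Xbar - g) ^ 2
        + ((a - b) ^ 2 * ∑ j, (cX j - Xbar) ^ 2
          - 2 * (a - b) * ∑ j, (cY j - Ybar) * (cX j - Xbar))
        + ((a + b) ^ 2 * ((1 / 3) * ∑ j, rX j ^ 2)
          - 2 * (a + b) * ((1 / 3) * ∑ j, rX j * rY j)) := by
  set w := Ybar - (a - b) * Xbar - g with hw
  have hconst : (m : ℝ) * w ^ 2 = ∑ _j : Fin m, w ^ 2 := by simp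
  have hcross : ∑ j, 2 * w * (cY j - Ybar) - ∑ j, 2 * w * (a - b) * (cX j - Xbar) = 0 := by
    rw [← Finset.mul_sum, ← Finset.mul_sum, hX, hY]
    ring
  rw [← sub_zero (∑ j, (_ + _)), ← hcross, hconst]
  simp only [Finset.mul_sum, ← Finset.sum_add_distrib, ← Finset.sum_sub_distrib]
  refine Finset.sum_congr rfl fun j _ => ?_
  rw [hw]
  ring

/-- Single-variable DSD fitting: if `S_c > 0`, `S_r > 0` and `(α*, β*, γ*)` is
a global minimizer of `f` over `{α ≥ 0, β ≥ 0, γ ∈ ℝ}` with `α* > 0` and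
`β* > 0`, then
`α* = (S_cc S_r + S_rr S_c)/(2 S_c S_r)`,
`β* = (−S_cc S_r + S_rr S_c)/(2 S_c S_r)` and `γ* = Ȳ − (α* − β*) X̄`. -/
theorem dsd_single_minimizer_interior (m : ℕ) (hm : 1 ≤ m)
    (cX rX cY rY : Fin m → ℝ) (hrX : ∀ j, 0 ≤ rX j) (hrY : ∀ j, 0 ≤ rY j)
    (f : ℝ → ℝ → ℝ → ℝ)
    (hf : f = fun a b g => ∑ j, ((cY j - (a - b) * cX j - g) ^ 2
        + (1 / 3) * (rY j - (a + b) * rX j) ^ 2))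
    (Xbar Ybar Sc Sr Scc Srr : ℝ)
    (hXbar : Xbar = (1 / (m : ℝ)) * ∑ j, cX j)
    (hYbar : Ybar = (1 / (m : ℝ)) * ∑ j, cY j)
    (hSc : Sc = ∑ j, (cX j - Xbar) ^ 2)
    (hSr : Sr = (1 / 3) * ∑ j, (rX j) ^ 2)
    (hScc : Scc = ∑ j, (cY j - Ybar) * (cX j - Xbar))
    (hSrr : Srr = (1 / 3) * ∑ j, rX j * rY j)
    (hScpos : 0 < Sc) (hSrpos : 0 < Sr)
    (α β γ : ℝ) (hα : 0 < α) (hβ : 0 < β)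
    (hmin : ∀ a b g : ℝ, 0 ≤ a → 0 ≤ b → f α β γ ≤ f a b g) :
    α = (Scc * Sr + Srr * Sc) / (2 * Sc * Sr)
    ∧ β = (-Scc * Sr + Srr * Sc) / (2 * Sc * Sr)
    ∧ γ = Ybar - (α - β) * Xbar := by
  have hm0 : (0 : ℝ) < m := by positivity
  have hSc0 := hScpos.ne'
  have hSr0 := hSrpos.ne'
  obtain ⟨K, hK⟩ : ∃ K : ℝ, ∀ a b g, f a b g = K + m * (Ybar - (a - b) * Xbar - g) ^ 2
      + Sc * (a - b - Scc / Sc) ^ 2 + Sr * (a + b - Srr / Sr) ^ 2 := by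
    refine ⟨∑ j, (cY j - Ybar) ^ 2 + (1 / 3) * ∑ j, rY j ^ 2
      - Scc ^ 2 / Sc - Srr ^ 2 / Sr, fun a b g => ?_⟩
    have h := dsd_objective_eq cX rX cY rY (sum_sub_mean_eq_zero hm cX hXbar)
      (sum_sub_mean_eq_zero hm cY hYbar) a b g
    rw [← hSc, ← hSr, ← hScc, ← hSrr] at h
    simp only [hf, h]
    field_simp
    ring
  set p := Scc / Sc with hp
  set q := Srr / Sr with hq
  obtain ⟨s₁, hs₁, h₁⟩ := exists_pos_forall_convex_combination_nonneg hα ((q + p) / 2)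
  obtain ⟨s₂, hs₂, h₂⟩ := exists_pos_forall_convex_combination_nonneg hβ ((q - p) / 2)
  obtain ⟨t, ht, htmin⟩ := exists_between (lt_min (lt_min hs₁ hs₂) one_pos)
  obtain ⟨htmin, ht1⟩ := lt_min_iff.mp htmin
  obtain ⟨hts₁, hts₂⟩ := lt_min_iff.mp htmin
  set E := m * (Ybar - (α - β) * Xbar - γ) ^ 2
      + Sc * (α - β - p) ^ 2 + Sr * (α + β - q) ^ 2 with hE
  have hEle : E ≤ (1 - t) ^ 2 * E := by
    have h := hmin _ _ (γ + t * (Ybar - p * Xbar - γ)) (h₁ t ht.le hts₁.le) (h₂ t ht.le hts₂.le)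
    rw [hK, hK] at h
    rw [hE]
    linear_combination h
  have hw := mul_nonneg hm0.le (sq_nonneg (Ybar - (α - β) * Xbar - γ))
  have hd := mul_nonneg hScpos.le (sq_nonneg (α - β - p))
  have hs := mul_nonneg hSrpos.le (sq_nonneg (α + β - q))
  have hE0 : E ≤ 0 := by
    by_contra! hpos
    nlinarith [mul_pos (mul_pos ht (by linarith : 0 < 2 - t)) hpos]
  have hw0 : Ybar - (α - β) * Xbar - γ = 0 := by
    have : m * (Ybar - (α - β) * Xbar - γ) ^ 2 = 0 := by linarith
    simpa [hm0.ne'] using this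
  have hd0 : α - β - p = 0 := by
    have : Sc * (α - β - p) ^ 2 = 0 := by linarith
    simpa [hSc0] using this
  have hs0 : α + β - q = 0 := by
    have : Sr * (α + β - q) ^ 2 = 0 := by linarith
    simpa [hSr0] using this
  refine ⟨?_, ?_, by linarith⟩
  · have : α = (p + q) / 2 := by linarith
    rw [this, hp, hq]
    field_simp
  · have : β = (-p + q) / 2 := by linarith
    rw [this, hp, hq]
    field_simp
end

section
/- Let (α*, β*, γ*) be a global minimizer of the DSD objective F over the feasible region {(α, β, γ) : α_k ≥ 0, β_k ≥ 0 for all k, γ ∈ ℝ}, with m ≥ 1. Then the symbolic mean of the predicted interval-valued variable equals Σ_{k=1}^p (α*_k − β*_k) X̄_k + γ*, where X̄_k = (1/m)Σ_j c_{X_k(j)}, and this common value equals the symbolic mean Ȳ = (1/m)Σ_j c_{Y(j)} of the observed variable; equivalently, (1/m)Σ_{j=1}^m [Σ_k (α*_k − β*_k) c_{X_k(j)} + γ*] = Ȳ. -/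
/-- If translating a finite real family by a constant never decreases its sum of squares, then the
family sums to zero. -/
theorem sum_eq_zero_of_sum_sq_le_sum_sub_sq {ι : Type*} [Fintype ι] (e : ι → ℝ)
    (h : ∀ t : ℝ, ∑ j, e j ^ 2 ≤ ∑ j, (e j - t) ^ 2) : ∑ j, e j = 0 := by
  cases isEmpty_or_nonempty ι
  · simp
  have hcard : (0 : ℝ) < Fintype.card ι := by exact_mod_cast Fintype.card_pos
  have expand (t : ℝ) : ∑ j, (e j - t) ^ 2
      = ∑ j, e j ^ 2 - 2 * t * ∑ j, e j + Fintype.card ι * t ^ 2 := by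
    simp only [sub_sq, Finset.sum_add_distrib, Finset.sum_sub_distrib, Finset.mul_sum,
      Finset.sum_const, Finset.card_univ, nsmul_eq_mul]
    congr 2
    exact Finset.sum_congr rfl fun j _ => by ring
  have hle := h ((∑ j, e j) / Fintype.card ι)
  rw [expand] at hle
  have hmean : (Fintype.card ι : ℝ) * ((∑ j, e j) / Fintype.card ι) = ∑ j, e j := by
    field_simp
  generalize (∑ j, e j) / (Fintype.card ι : ℝ) = t at hle hmean
  rw [← hmean] at hle ⊢
  have ht : t ^ 2 = 0 := le_antisymm (by nlinarith) (sq_nonneg t)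
  rw [sq_eq_zero_iff] at ht
  simp [ht]

/-- If `(α*, β*, γ*)` is a global minimizer of the DSD objective `F` over the
feasible region `{α_k ≥ 0, β_k ≥ 0, γ ∈ ℝ}`, then the symbolic mean of the
predicted interval-valued variable equals `Σ_k (α*_k − β*_k) X̄_k + γ*`, and
this common value equals the symbolic mean `Ȳ` of the observed variable. -/
theorem dsd_minimizer_mean_prediction (m p : ℕ) (hm : 1 ≤ m)
    (c r : Fin p → Fin m → ℝ) (hr : ∀ k j, 0 ≤ r k j)
    (cY rY : Fin m → ℝ) (hrY : ∀ j, 0 ≤ rY j)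
    (F : (Fin p → ℝ) → (Fin p → ℝ) → ℝ → ℝ)
    (hF : F = fun α β γ => ∑ j, ((cY j - (∑ k, (α k - β k) * c k j) - γ) ^ 2
        + (1 / 3) * (rY j - (∑ k, (α k + β k) * r k j)) ^ 2))
    (α β : Fin p → ℝ) (γ : ℝ) (hα : ∀ k, 0 ≤ α k) (hβ : ∀ k, 0 ≤ β k)
    (hmin : ∀ (a b : Fin p → ℝ) (g : ℝ), (∀ k, 0 ≤ a k) → (∀ k, 0 ≤ b k) →
      F α β γ ≤ F a b g) :
    (1 / (m : ℝ)) * ∑ j, ((∑ k, (α k - β k) * c k j) + γ)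
        = (∑ k, (α k - β k) * ((1 / (m : ℝ)) * ∑ j, c k j)) + γ
    ∧ (1 / (m : ℝ)) * ∑ j, ((∑ k, (α k - β k) * c k j) + γ)
        = (1 / (m : ℝ)) * ∑ j, cY j := by
  have hm0 : (m : ℝ) ≠ 0 := by exact_mod_cast (show m ≠ 0 by omega)
  constructor
  · rw [Finset.sum_add_distrib, Finset.sum_comm, mul_add]
    congr 1
    · simp only [← Finset.mul_sum]
      rw [Finset.mul_sum]
      exact Finset.sum_congr rfl fun k _ => by ring
    · simp only [Finset.sum_const, Finset.card_univ, Fintype.card_fin, nsmul_eq_mul]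
      field_simp
  · have hres : ∑ j, (cY j - (∑ k, (α k - β k) * c k j) - γ) = 0 := by
      refine sum_eq_zero_of_sum_sq_le_sum_sub_sq _ fun t => ?_
      have hle := hmin α β (γ + t) hα hβ
      simp only [hF, Finset.sum_add_distrib, add_le_add_iff_right] at hle
      simpa only [sub_sub, add_assoc] using hle
    simp only [sub_sub, Finset.sum_sub_distrib] at hres
    rw [sub_eq_zero.mp hres]
end

section
/- Let (α*, β*, γ*) be a global minimizer of the DSD objective F over the feasible region {(α, β, γ) : α_k ≥ 0, β_k ≥ 0 for all k, γ ∈ ℝ}, with m ≥ 1, and let Ψ_Ŷ(j) be the corresponding predicted quantile functions. Then the total sum of squares decomposes as Σ_{j=1}^m D_M²(Ψ_{Y(j)}, Ψ̄) = Σ_{j=1}^m D_M²(Ψ_{Y(j)}, Ψ_Ŷ(j)) + Σ_{j=1}^m D_M²(Ψ_Ŷ(j), Ψ̄), where Ψ̄ denotes the constant function on [0,1] with value Ȳ = (1/m)Σ_j c_{Y(j)}. -/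
/-- The squared Mallows norm of an affine quantile function in centre/half-range form. -/
lemma integral_sq_center_add_range (a b : ℝ) :
    ∫ t in (0:ℝ)..1, (a + b * (2 * t - 1)) ^ 2 = a ^ 2 + b ^ 2 / 3 := by
  have h : ∀ t ∈ Set.uIcc (0:ℝ) 1,
      HasDerivAt (fun t : ℝ => (a - b) ^ 2 * t + 2 * (a - b) * b * t ^ 2 + 4 * b ^ 2 / 3 * t ^ 3)
        ((a + b * (2 * t - 1)) ^ 2) t := by
    intro t _
    have := (((hasDerivAt_id t).const_mul ((a - b) ^ 2)).add
      ((hasDerivAt_pow 2 t).const_mul (2 * (a - b) * b))).add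
      ((hasDerivAt_pow 3 t).const_mul (4 * b ^ 2 / 3))
    refine this.congr_deriv ?_
    norm_num
    ring
  rw [intervalIntegral.integral_eq_sub_of_hasDerivAt h
    (Continuous.intervalIntegrable (by fun_prop) _ _)]
  ring

/-- If a quadratic vanishing at `0` is nonnegative on `[-1, 1]`, its linear coefficient is zero. -/
lemma linear_coeff_eq_zero_of_quadratic_nonneg {P Q : ℝ}
    (h : ∀ x : ℝ, |x| ≤ 1 → 0 ≤ x ^ 2 * Q - 2 * x * P) : P = 0 := by
  have hP := abs_nonneg P
  have hQ := abs_nonneg Q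
  have hD : 0 < |P| + |Q| + 1 := by positivity
  have hx := h (P / (|P| + |Q| + 1)) (by
    rw [abs_div, abs_of_pos hD, div_le_one hD]
    linarith)
  have key : (P / (|P| + |Q| + 1)) ^ 2 * Q - 2 * (P / (|P| + |Q| + 1)) * P
      = (P / (|P| + |Q| + 1)) ^ 2 * (Q - 2 * (|P| + |Q| + 1)) := by
    field_simp
  rw [key] at hx
  have hneg : Q - 2 * (|P| + |Q| + 1) < 0 := by linarith [le_abs_self Q]
  have hsq := nonpos_of_mul_nonneg_left hx hneg
  have hzero : P / (|P| + |Q| + 1) = 0 := pow_eq_zero_iff two_ne_zero |>.mp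
    (le_antisymm hsq (sq_nonneg _))
  exact (div_eq_zero_iff.mp hzero).resolve_right hD.ne'

/-- At a global minimizer `(α*, β*, γ*)` of the DSD objective
`F(α,β,γ) = Σ_j D_M²(Ψ_{Y(j)}, Ψ_Ŷ(j))` over `{α_k ≥ 0, β_k ≥ 0, γ ∈ ℝ}`,
the total sum of squares decomposes as
`Σ_j D_M²(Ψ_{Y(j)}, Ψ̄) = Σ_j D_M²(Ψ_{Y(j)}, Ψ_Ŷ(j)) + Σ_j D_M²(Ψ_Ŷ(j), Ψ̄)`,
where `Ψ̄` is the constant function with value `Ȳ = (1/m) Σ_j c_{Y(j)}`. -/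
theorem dsd_sum_of_squares_decomposition (m p : ℕ) (hm : 1 ≤ m)
    (c r : Fin p → Fin m → ℝ) (hr : ∀ k j, 0 ≤ r k j)
    (cY rY : Fin m → ℝ) (hrY : ∀ j, 0 ≤ rY j)
    (F : (Fin p → ℝ) → (Fin p → ℝ) → ℝ → ℝ)
    (hF : F = fun α β γ => ∑ j, ∫ t in (0:ℝ)..1,
        ((cY j + rY j * (2 * t - 1))
          - ((∑ k, (α k - β k) * c k j) + γ
              + (∑ k, (α k + β k) * r k j) * (2 * t - 1))) ^ 2)
    (α β : Fin p → ℝ) (γ : ℝ) (hα : ∀ k, 0 ≤ α k) (hβ : ∀ k, 0 ≤ β k)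
    (hmin : ∀ (a b : Fin p → ℝ) (g : ℝ), (∀ k, 0 ≤ a k) → (∀ k, 0 ≤ b k) →
      F α β γ ≤ F a b g)
    (Ybar : ℝ) (hYbar : Ybar = (1 / (m : ℝ)) * ∑ j, cY j) :
    (∑ j, ∫ t in (0:ℝ)..1, ((cY j + rY j * (2 * t - 1)) - Ybar) ^ 2)
      = (∑ j, ∫ t in (0:ℝ)..1,
          ((cY j + rY j * (2 * t - 1))
            - ((∑ k, (α k - β k) * c k j) + γ
                + (∑ k, (α k + β k) * r k j) * (2 * t - 1))) ^ 2)
        + (∑ j, ∫ t in (0:ℝ)..1,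
            (((∑ k, (α k - β k) * c k j) + γ
                + (∑ k, (α k + β k) * r k j) * (2 * t - 1)) - Ybar) ^ 2) := by
  subst hF
  set u : Fin m → ℝ := fun j => ∑ k, (α k - β k) * c k j
  set v : Fin m → ℝ := fun j => ∑ k, (α k + β k) * r k j
  have integral_sub_sq : ∀ a b a' b' : ℝ,
      ∫ t in (0:ℝ)..1, ((a + b * (2 * t - 1)) - (a' + b' * (2 * t - 1))) ^ 2
        = (a - a') ^ 2 + (b - b') ^ 2 / 3 := by
    intro a b a' b'
    rw [← integral_sq_center_add_range]
    congr 1 with t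
    ring
  have integral_sub_const_sq : ∀ a b y : ℝ,
      ∫ t in (0:ℝ)..1, ((a + b * (2 * t - 1)) - y) ^ 2 = (a - y) ^ 2 + b ^ 2 / 3 := by
    intro a b y
    simpa using integral_sub_sq a b y 0
  have hscale : ∀ s g : ℝ, 0 ≤ s →
      ∑ j, ((cY j - (u j + γ)) ^ 2 + (rY j - v j) ^ 2 / 3)
        ≤ ∑ j, ((cY j - (s * u j + g)) ^ 2 + (rY j - s * v j) ^ 2 / 3) := by
    intro s g hs
    have h := hmin (fun k => s * α k) (fun k => s * β k) g
      (fun k => mul_nonneg hs (hα k)) (fun k => mul_nonneg hs (hβ k))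
    simp only [integral_sub_sq] at h
    simp only [← mul_sub, ← mul_add, mul_assoc, ← Finset.mul_sum] at h
    exact h
  have hresid : ∑ j, (cY j - (u j + γ)) = 0 := by
    refine linear_coeff_eq_zero_of_quadratic_nonneg (Q := ∑ _j : Fin m, 1) fun x _ => ?_
    have h := sub_nonneg.mpr (hscale 1 (γ + x) zero_le_one)
    rw [← Finset.sum_sub_distrib] at h
    rw [Finset.mul_sum, Finset.mul_sum, ← Finset.sum_sub_distrib]
    refine h.trans_eq (Finset.sum_congr rfl fun j _ => ?_)
    ring
  have horth : ∑ j, ((cY j - (u j + γ)) * u j + (rY j - v j) * v j / 3) = 0 := by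
    refine linear_coeff_eq_zero_of_quadratic_nonneg (Q := ∑ j, (u j ^ 2 + v j ^ 2 / 3))
      fun x hx => ?_
    have h := sub_nonneg.mpr (hscale (1 + x) γ (by linarith [(abs_le.mp hx).1]))
    rw [← Finset.sum_sub_distrib] at h
    rw [Finset.mul_sum, Finset.mul_sum, ← Finset.sum_sub_distrib]
    refine h.trans_eq (Finset.sum_congr rfl fun j _ => ?_)
    ring
  simp only [integral_sub_sq, integral_sub_const_sq]
  have hsplit : ∑ j, ((cY j - Ybar) ^ 2 + rY j ^ 2 / 3)
      = ∑ j, ((cY j - (u j + γ)) ^ 2 + (rY j - v j) ^ 2 / 3)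
        + ∑ j, ((u j + γ - Ybar) ^ 2 + v j ^ 2 / 3)
        + 2 * (γ - Ybar) * ∑ j, (cY j - (u j + γ))
        + 2 * ∑ j, ((cY j - (u j + γ)) * u j + (rY j - v j) * v j / 3) := by
    simp only [Finset.mul_sum, ← Finset.sum_add_distrib]
    refine Finset.sum_congr rfl fun j _ => ?_
    ring
  rw [hresid, horth, mul_zero, mul_zero, add_zero, add_zero] at hsplit
  exact hsplit
end
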